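/- Let A_1 and A_2 be complex 2×2 matrices with det A_1 = det A_2 = 1. Then there exist 2×2 complex unitary matrices U_1, U_2, V such that U_1† A_1 V is upper-triangular with both diagonal entries equal to 1 and U_2† A_2 V is lower-triangular with both diagonal entries equal to 1, if and only if F_2(A_1†A_1 − I, A_2†A_2 − I) ≥ 0. -/

import Mathlib

open Matrix ComplexOrder

/-- `F₂(S₁, S₂) = det (S₁ · S₂ − adj(S₂) · adj(S₁))`. -/
noncomputable def F2 {n : ℕ} (S₁ S₂ : Matrix (Fin n) (Fin n) ℂ) : ℂ :=
  (S₁ * S₂ - S₂.adjugate * S₁.adjugate).det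

/-- Two affine planes of `ℝ³` with independent normals `s`, `t` have a common point on the unit
sphere as soon as their line of intersection is at distance at most one from the origin. -/
lemma exists_mem_sphere_of_cross_pos {s₀ s₁ s₂ s₃ t₀ t₁ t₂ t₃ : ℝ}
    (hpos : 0 < (s₂ * t₃ - s₃ * t₂) ^ 2 + (s₃ * t₁ - s₁ * t₃) ^ 2 + (s₁ * t₂ - s₂ * t₁) ^ 2)
    (h : (t₀ * s₁ - s₀ * t₁) ^ 2 + (t₀ * s₂ - s₀ * t₂) ^ 2 + (t₀ * s₃ - s₀ * t₃) ^ 2 ≤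
      (s₂ * t₃ - s₃ * t₂) ^ 2 + (s₃ * t₁ - s₁ * t₃) ^ 2 + (s₁ * t₂ - s₂ * t₁) ^ 2) :
    ∃ x y z : ℝ, x ^ 2 + y ^ 2 + z ^ 2 = 1 ∧ s₀ + (s₁ * x + s₂ * y + s₃ * z) = 0 ∧
      t₀ + (t₁ * x + t₂ * y + t₃ * z) = 0 := by
  obtain ⟨c₁, hc₁⟩ : ∃ c, c = s₂ * t₃ - s₃ * t₂ := ⟨_, rfl⟩
  obtain ⟨c₂, hc₂⟩ : ∃ c, c = s₃ * t₁ - s₁ * t₃ := ⟨_, rfl⟩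
  obtain ⟨c₃, hc₃⟩ : ∃ c, c = s₁ * t₂ - s₂ * t₁ := ⟨_, rfl⟩
  obtain ⟨w₁, hw₁⟩ : ∃ w, w = t₀ * s₁ - s₀ * t₁ := ⟨_, rfl⟩
  obtain ⟨w₂, hw₂⟩ : ∃ w, w = t₀ * s₂ - s₀ * t₂ := ⟨_, rfl⟩
  obtain ⟨w₃, hw₃⟩ : ∃ w, w = t₀ * s₃ - s₀ * t₃ := ⟨_, rfl⟩
  rw [← hc₁, ← hc₂, ← hc₃] at h hpos
  rw [← hw₁, ← hw₂, ← hw₃] at h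
  obtain ⟨D, hD⟩ : ∃ D, D = c₁ ^ 2 + c₂ ^ 2 + c₃ ^ 2 := ⟨_, rfl⟩
  rw [← hD] at h hpos
  obtain ⟨k, hk⟩ : ∃ k, k ^ 2 = D - (w₁ ^ 2 + w₂ ^ 2 + w₃ ^ 2) :=
    ⟨_, Real.sq_sqrt (by linarith)⟩
  have hwc : w₁ * c₁ + w₂ * c₂ + w₃ * c₃ = 0 := by subst_vars; ring
  have hsc : s₁ * c₁ + s₂ * c₂ + s₃ * c₃ = 0 := by subst_vars; ring
  have htc : t₁ * c₁ + t₂ * c₂ + t₃ * c₃ = 0 := by subst_vars; ring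
  have hsw : s₁ * (w₂ * c₃ - w₃ * c₂) + s₂ * (w₃ * c₁ - w₁ * c₃) + s₃ * (w₁ * c₂ - w₂ * c₁) =
      -(s₀ * D) := by
    subst_vars; ring
  have htw : t₁ * (w₂ * c₃ - w₃ * c₂) + t₂ * (w₃ * c₁ - w₁ * c₃) + t₃ * (w₁ * c₂ - w₂ * c₁) =
      -(t₀ * D) := by
    subst_vars; ring
  have hD0 : D ≠ 0 := hpos.ne'
  refine ⟨(w₂ * c₃ - w₃ * c₂ + k * c₁) / D, (w₃ * c₁ - w₁ * c₃ + k * c₂) / D,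
    (w₁ * c₂ - w₂ * c₁ + k * c₃) / D, ?_, ?_, ?_⟩
  · field_simp
    linear_combination (c₁ ^ 2 + c₂ ^ 2 + c₃ ^ 2) * hk - D * hD -
      (w₁ * c₁ + w₂ * c₂ + w₃ * c₃) * hwc
  · field_simp
    linear_combination hsw + k * hsc
  · field_simp
    linear_combination htw + k * htc

/-- A plane of `ℝ³` with nonzero normal at distance at most one from the origin meets the unit
sphere. -/
lemma exists_mem_sphere_of_normal_pos {s₀ s₁ s₂ s₃ : ℝ} (hpos : 0 < s₁ ^ 2 + s₂ ^ 2 + s₃ ^ 2)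
    (h : s₀ ^ 2 ≤ s₁ ^ 2 + s₂ ^ 2 + s₃ ^ 2) :
    ∃ x y z : ℝ, x ^ 2 + y ^ 2 + z ^ 2 = 1 ∧ s₀ + (s₁ * x + s₂ * y + s₃ * z) = 0 := by
  obtain ⟨t₁, t₂, t₃, ht, hst⟩ : ∃ t₁ t₂ t₃ : ℝ, 0 < t₁ ^ 2 + t₂ ^ 2 + t₃ ^ 2 ∧
      s₁ * t₁ + s₂ * t₂ + s₃ * t₃ = 0 := by
    by_cases hs : s₁ ^ 2 + s₂ ^ 2 = 0
    · have hs₁ : s₁ = 0 := by nlinarith [sq_nonneg s₁, sq_nonneg s₂]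
      exact ⟨1, 0, 0, by norm_num, by simp [hs₁]⟩
    · exact ⟨s₂, -s₁, 0, lt_of_le_of_ne (by positivity) (by contrapose! hs; linarith), by ring⟩
  have hcross : (s₂ * t₃ - s₃ * t₂) ^ 2 + (s₃ * t₁ - s₁ * t₃) ^ 2 + (s₁ * t₂ - s₂ * t₁) ^ 2 =
      (s₁ ^ 2 + s₂ ^ 2 + s₃ ^ 2) * (t₁ ^ 2 + t₂ ^ 2 + t₃ ^ 2) := by
    linear_combination -(s₁ * t₁ + s₂ * t₂ + s₃ * t₃) * hst
  obtain ⟨x, y, z, hn, hs, -⟩ := exists_mem_sphere_of_cross_pos (s₀ := s₀) (t₀ := 0)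
    (by rw [hcross]; positivity) (by rw [hcross]; nlinarith)
  exact ⟨x, y, z, hn, hs⟩

lemma eq_zero_of_sum_sq_nonpos {x y z : ℝ} (h : x ^ 2 + y ^ 2 + z ^ 2 ≤ 0) :
    x = 0 ∧ y = 0 ∧ z = 0 := by
  refine ⟨?_, ?_, ?_⟩ <;> nlinarith [sq_nonneg x, sq_nonneg y, sq_nonneg z]

/-- Two planes of `ℝ³`, each at distance at most one from the origin, have a common point on the
unit sphere iff their line of intersection is at distance at most one from the origin. -/
lemma exists_mem_sphere_iff {s₀ s₁ s₂ s₃ t₀ t₁ t₂ t₃ : ℝ}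
    (hs : s₀ ^ 2 ≤ s₁ ^ 2 + s₂ ^ 2 + s₃ ^ 2) (ht : t₀ ^ 2 ≤ t₁ ^ 2 + t₂ ^ 2 + t₃ ^ 2) :
    (∃ x y z : ℝ, x ^ 2 + y ^ 2 + z ^ 2 = 1 ∧ s₀ + (s₁ * x + s₂ * y + s₃ * z) = 0 ∧
      t₀ + (t₁ * x + t₂ * y + t₃ * z) = 0) ↔
    (t₀ * s₁ - s₀ * t₁) ^ 2 + (t₀ * s₂ - s₀ * t₂) ^ 2 + (t₀ * s₃ - s₀ * t₃) ^ 2 ≤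
      (s₂ * t₃ - s₃ * t₂) ^ 2 + (s₃ * t₁ - s₁ * t₃) ^ 2 + (s₁ * t₂ - s₂ * t₁) ^ 2 := by
  constructor
  · rintro ⟨x, y, z, hn, h₁, h₂⟩
    obtain rfl : s₀ = -(s₁ * x + s₂ * y + s₃ * z) := by linarith
    obtain rfl : t₀ = -(t₁ * x + t₂ * y + t₃ * z) := by linarith
    have := sq_nonneg (x * (s₂ * t₃ - s₃ * t₂) + y * (s₃ * t₁ - s₁ * t₃) +
      z * (s₁ * t₂ - s₂ * t₁))
    linear_combination this + ((s₂ * t₃ - s₃ * t₂) ^ 2 + (s₃ * t₁ - s₁ * t₃) ^ 2 +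
      (s₁ * t₂ - s₂ * t₁) ^ 2) * hn
  · intro h
    rcases (by positivity : 0 ≤ (s₂ * t₃ - s₃ * t₂) ^ 2 + (s₃ * t₁ - s₁ * t₃) ^ 2 +
      (s₁ * t₂ - s₂ * t₁) ^ 2).eq_or_lt with hD | hD
    · rw [← hD] at h
      obtain ⟨e₁, e₂, e₃⟩ := eq_zero_of_sum_sq_nonpos h
      obtain ⟨c₁, c₂, c₃⟩ := eq_zero_of_sum_sq_nonpos hD.ge
      rcases (by positivity : 0 ≤ s₁ ^ 2 + s₂ ^ 2 + s₃ ^ 2).eq_or_lt with hs' | hs'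
      · obtain rfl : s₀ = 0 := by nlinarith
        obtain rfl : s₁ = 0 := by nlinarith
        obtain rfl : s₂ = 0 := by nlinarith
        obtain rfl : s₃ = 0 := by nlinarith
        rcases (by positivity : 0 ≤ t₁ ^ 2 + t₂ ^ 2 + t₃ ^ 2).eq_or_lt with ht' | ht'
        · obtain rfl : t₀ = 0 := by nlinarith
          obtain rfl : t₁ = 0 := by nlinarith
          exact ⟨1, 0, 0, by norm_num, by norm_num, by norm_num⟩
        · obtain ⟨x, y, z, hn, h'⟩ := exists_mem_sphere_of_normal_pos ht' ht
          exact ⟨x, y, z, hn, by ring, h'⟩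
      · obtain ⟨x, y, z, hn, h'⟩ := exists_mem_sphere_of_normal_pos hs' hs
        refine ⟨x, y, z, hn, h', ?_⟩
        refine (mul_eq_zero.1 ?_).resolve_left hs'.ne'
        linear_combination s₁ * e₁ + s₂ * e₂ + s₃ * e₃ + (s₁ * t₁ + s₂ * t₂ + s₃ * t₃) * h' +
          c₁ * (s₂ * z - s₃ * y) + c₂ * (s₃ * x - s₁ * z) + c₃ * (s₁ * y - s₂ * x)
    · exact exists_mem_sphere_of_cross_pos hD h

/-- Every point of the unit sphere is the image of a unit vector of `ℂ²` under the Hopf map. -/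
lemma exists_hopf_eq {x y z : ℝ} (h : x ^ 2 + y ^ 2 + z ^ 2 = 1) :
    ∃ a b : ℂ, star a * a = ((1 + z) / 2 : ℝ) ∧ star b * b = ((1 - z) / 2 : ℝ) ∧
      star a * b = (x + y * Complex.I) / 2 := by
  have hz : 0 ≤ 1 + z := by nlinarith
  rcases hz.eq_or_lt with hz | hz
  · obtain rfl : z = -1 := by linarith
    obtain rfl : x = 0 := by nlinarith
    obtain rfl : y = 0 := by nlinarith
    exact ⟨0, 1, by norm_num, by norm_num, by norm_num⟩
  · obtain ⟨r, hr, hrz⟩ : ∃ r : ℝ, r ≠ 0 ∧ r ^ 2 = (1 + z) / 2 :=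
      ⟨√((1 + z) / 2), by positivity, Real.sq_sqrt (by positivity)⟩
    refine ⟨r, (x + y * Complex.I) / (2 * r), ?_, ?_, ?_⟩
    · rw [← hrz]; simp [sq]
    · have hrC : (r : ℂ) ≠ 0 := by exact_mod_cast hr
      have hrzC : (r : ℂ) ^ 2 = (1 + z) / 2 := by exact_mod_cast hrz
      have hC : (x : ℂ) ^ 2 + y ^ 2 + z ^ 2 = 1 := by exact_mod_cast h
      simp
      field_simp
      linear_combination hC - y ^ 2 * Complex.I_sq - 2 * (1 - (z : ℂ)) * hrzC
    · have hrC : (r : ℂ) ≠ 0 := by exact_mod_cast hr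
      simp
      field_simp

namespace Matrix

/-- `QR` decomposition with unit diagonal of a `2 × 2` matrix. -/
lemma exists_unitary_upper_iff {M : Matrix (Fin 2) (Fin 2) ℂ} (hM : star M.det * M.det = 1) :
    (∃ U ∈ unitaryGroup (Fin 2) ℂ, (Uᴴ * M).BlockTriangular id ∧ ∀ j, (Uᴴ * M) j j = 1) ↔
      (Mᴴ * M) 0 0 = 1 := by
  constructor
  · rintro ⟨U, hU, hT, hd⟩
    have h : (Uᴴ * M)ᴴ * (Uᴴ * M) = Mᴴ * M := by
      rw [conjTranspose_mul, conjTranspose_conjTranspose, Matrix.mul_assoc, ← Matrix.mul_assoc U,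
        ← star_eq_conjTranspose U, mem_unitaryGroup_iff.1 hU, Matrix.one_mul]
    have h10 : (Uᴴ * M) 1 0 = 0 := hT (by decide : (0 : Fin 2) < 1)
    rw [← h, mul_apply, Fin.sum_univ_two, conjTranspose_apply, conjTranspose_apply, hd 0, h10]
    simp
  · intro h
    rw [mul_apply, Fin.sum_univ_two, conjTranspose_apply, conjTranspose_apply] at h
    obtain ⟨d, hd⟩ : ∃ d, d = M.det := ⟨_, rfl⟩
    rw [← hd] at hM
    rw [det_fin_two] at hd
    simp only [Complex.star_def] at h hM
    refine ⟨!![M 0 0, -(star (M 1 0) * d); M 1 0, star (M 0 0) * d], ?_, ?_, ?_⟩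
    · rw [mem_unitaryGroup_iff']
      ext i j
      fin_cases i <;> fin_cases j <;> simp [star_eq_conjTranspose, mul_apply, Fin.sum_univ_two]
      · exact h
      · ring
      · ring
      · linear_combination hM + starRingEnd ℂ d * d * h
    · intro i j hij
      fin_cases i <;> fin_cases j <;> simp [mul_apply, Fin.sum_univ_two] at hij ⊢
      ring
    · intro j
      fin_cases j <;> simp [mul_apply, Fin.sum_univ_two]
      · exact h
      · linear_combination hM - starRingEnd ℂ d * hd

/-- `QL` decomposition with unit diagonal of a `2 × 2` matrix. -/
lemma exists_unitary_lower_iff {M : Matrix (Fin 2) (Fin 2) ℂ} (hM : star M.det * M.det = 1) :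
    (∃ U ∈ unitaryGroup (Fin 2) ℂ, (Uᴴ * M)ᵀ.BlockTriangular id ∧ ∀ j, (Uᴴ * M) j j = 1) ↔
      (Mᴴ * M) 1 1 = 1 := by
  constructor
  · rintro ⟨U, hU, hT, hd⟩
    have h : (Uᴴ * M)ᴴ * (Uᴴ * M) = Mᴴ * M := by
      rw [conjTranspose_mul, conjTranspose_conjTranspose, Matrix.mul_assoc, ← Matrix.mul_assoc U,
        ← star_eq_conjTranspose U, mem_unitaryGroup_iff.1 hU, Matrix.one_mul]
    have h01 : (Uᴴ * M) 0 1 = 0 := hT (by decide : (0 : Fin 2) < 1)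
    rw [← h, mul_apply, Fin.sum_univ_two, conjTranspose_apply, conjTranspose_apply, hd 1, h01]
    simp
  · intro h
    rw [mul_apply, Fin.sum_univ_two, conjTranspose_apply, conjTranspose_apply] at h
    obtain ⟨d, hd⟩ : ∃ d, d = M.det := ⟨_, rfl⟩
    rw [← hd] at hM
    rw [det_fin_two] at hd
    simp only [Complex.star_def] at h hM
    refine ⟨!![star (M 1 1) * d, M 0 1; -(star (M 0 1) * d), M 1 1], ?_, ?_, ?_⟩
    · rw [mem_unitaryGroup_iff']
      ext i j
      fin_cases i <;> fin_cases j <;> simp [star_eq_conjTranspose, mul_apply, Fin.sum_univ_two]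
      · linear_combination hM + starRingEnd ℂ d * d * h
      · ring
      · ring
      · exact h
    · intro i j hij
      fin_cases i <;> fin_cases j <;> simp [mul_apply, Fin.sum_univ_two] at hij ⊢
      ring
    · intro j
      fin_cases j <;> simp [mul_apply, Fin.sum_univ_two]
      · linear_combination hM - starRingEnd ℂ d * hd
      · exact h

/-- The Hermitian `2 × 2` matrix with the given coordinates in the basis of Pauli matrices. -/
noncomputable def pauli (s₀ s₁ s₂ s₃ : ℝ) : Matrix (Fin 2) (Fin 2) ℂ :=
  !![s₀ + s₃, s₁ - s₂ * Complex.I; s₁ + s₂ * Complex.I, s₀ - s₃]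

lemma exists_conjTranspose_mul_self_sub_one_eq_pauli {A : Matrix (Fin 2) (Fin 2) ℂ}
    (hA : A.det = 1) :
    ∃ s₀ s₁ s₂ s₃ : ℝ, s₀ ^ 2 ≤ s₁ ^ 2 + s₂ ^ 2 + s₃ ^ 2 ∧
      Aᴴ * A - 1 = pauli s₀ s₁ s₂ s₃ := by
  obtain ⟨p, hp⟩ : ∃ p, p = Complex.normSq (A 0 0) + Complex.normSq (A 1 0) := ⟨_, rfl⟩
  obtain ⟨q, hq⟩ : ∃ q, q = Complex.normSq (A 0 1) + Complex.normSq (A 1 1) := ⟨_, rfl⟩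
  obtain ⟨w, hw⟩ : ∃ w, w = star (A 0 1) * A 0 0 + star (A 1 1) * A 1 0 := ⟨_, rfl⟩
  have hp0 : 0 ≤ p := by
    rw [hp]
    exact add_nonneg (Complex.normSq_nonneg _) (Complex.normSq_nonneg _)
  have hq0 : 0 ≤ q := by
    rw [hq]
    exact add_nonneg (Complex.normSq_nonneg _) (Complex.normSq_nonneg _)
  have hdet : p * q - (w.re ^ 2 + w.im ^ 2) = 1 := by
    have h : Complex.normSq A.det = 1 := by simp [hA]
    rw [← h, hp, hq, hw, det_fin_two]
    simp [Complex.normSq_apply]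
    ring
  refine ⟨(p + q) / 2 - 1, w.re, w.im, (p - q) / 2, ?_, ?_⟩
  · nlinarith [sq_nonneg (p - q), sq_nonneg w.re, sq_nonneg w.im]
  · subst hp hq hw
    ext i j
    fin_cases i <;> fin_cases j <;> apply Complex.ext <;>
      simp [pauli, mul_apply, Fin.sum_univ_two, Complex.normSq_apply] <;> ring

lemma F2_pauli (s₀ s₁ s₂ s₃ t₀ t₁ t₂ t₃ : ℝ) :
    F2 (pauli s₀ s₁ s₂ s₃) (pauli t₀ t₁ t₂ t₃) =
      ((4 * (((s₂ * t₃ - s₃ * t₂) ^ 2 + (s₃ * t₁ - s₁ * t₃) ^ 2 + (s₁ * t₂ - s₂ * t₁) ^ 2) -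
        ((t₀ * s₁ + s₀ * t₁) ^ 2 + (t₀ * s₂ + s₀ * t₂) ^ 2 + (t₀ * s₃ + s₀ * t₃) ^ 2)) : ℝ) :
          ℂ) := by
  rw [F2, det_fin_two]
  apply Complex.ext
  · rw [Complex.ofReal_re]
    simp [pauli, adjugate_fin_two]
    ring
  · rw [Complex.ofReal_im]
    simp [pauli, adjugate_fin_two]
    ring

lemma conjTranspose_mul_pauli_mul_apply_zero {V : Matrix (Fin 2) (Fin 2) ℂ} {x y z : ℝ}
    (h₀ : star (V 0 0) * V 0 0 = ((1 + z) / 2 : ℝ)) (h₁ : star (V 1 0) * V 1 0 = ((1 - z) / 2 : ℝ))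
    (h₂ : star (V 0 0) * V 1 0 = (x + y * Complex.I) / 2) (s₀ s₁ s₂ s₃ : ℝ) :
    (Vᴴ * pauli s₀ s₁ s₂ s₃ * V) 0 0 = ((s₀ + (s₁ * x + s₂ * y + s₃ * z) : ℝ) : ℂ) := by
  have h₃ := congrArg star h₂
  simp [mul_apply, Fin.sum_univ_two, pauli] at h₀ h₁ h₂ h₃ ⊢
  linear_combination (s₀ + s₃ : ℂ) * h₀ + (s₀ - s₃ : ℂ) * h₁ + (s₁ - s₂ * Complex.I) * h₂ +
    (s₁ + s₂ * Complex.I) * h₃ - s₂ * y * Complex.I_sq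

lemma conjTranspose_mul_mul_apply_one {V : Matrix (Fin 2) (Fin 2) ℂ}
    (hV : V ∈ unitaryGroup (Fin 2) ℂ) (S : Matrix (Fin 2) (Fin 2) ℂ) :
    (Vᴴ * S * V) 1 1 = S 0 0 + S 1 1 - (Vᴴ * S * V) 0 0 := by
  have h : (Vᴴ * S * V).trace = S.trace := by
    rw [trace_mul_comm, ← Matrix.mul_assoc, ← star_eq_conjTranspose, mem_unitaryGroup_iff.1 hV,
      Matrix.one_mul]
  rw [trace_fin_two, trace_fin_two] at h
  linear_combination h

lemma exists_unitary_pauli_iff (s₀ s₁ s₂ s₃ t₀ t₁ t₂ t₃ : ℝ) :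
    (∃ V ∈ unitaryGroup (Fin 2) ℂ, (Vᴴ * pauli s₀ s₁ s₂ s₃ * V) 0 0 = 0 ∧
      (Vᴴ * pauli t₀ t₁ t₂ t₃ * V) 1 1 = 0) ↔
    ∃ x y z : ℝ, x ^ 2 + y ^ 2 + z ^ 2 = 1 ∧ s₀ + (s₁ * x + s₂ * y + s₃ * z) = 0 ∧
      t₀ + (-t₁ * x + -t₂ * y + -t₃ * z) = 0 := by
  have key : ∀ V ∈ unitaryGroup (Fin 2) ℂ, ∀ x y z : ℝ,
      star (V 0 0) * V 0 0 = ((1 + z) / 2 : ℝ) → star (V 1 0) * V 1 0 = ((1 - z) / 2 : ℝ) →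
      star (V 0 0) * V 1 0 = (x + y * Complex.I) / 2 →
      (((Vᴴ * pauli s₀ s₁ s₂ s₃ * V) 0 0 = 0 ∧ (Vᴴ * pauli t₀ t₁ t₂ t₃ * V) 1 1 = 0) ↔
        (s₀ + (s₁ * x + s₂ * y + s₃ * z) = 0 ∧ t₀ + (-t₁ * x + -t₂ * y + -t₃ * z) = 0)) := by
    intro V hV x y z h₀ h₁ h₂
    have ht : pauli t₀ t₁ t₂ t₃ 0 0 + pauli t₀ t₁ t₂ t₃ 1 1 -
        ((t₀ + (t₁ * x + t₂ * y + t₃ * z) : ℝ) : ℂ) =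
          ((t₀ + (-t₁ * x + -t₂ * y + -t₃ * z) : ℝ) : ℂ) := by
      simp [pauli]
      ring
    rw [conjTranspose_mul_mul_apply_one hV, conjTranspose_mul_pauli_mul_apply_zero h₀ h₁ h₂,
      conjTranspose_mul_pauli_mul_apply_zero h₀ h₁ h₂, ht, Complex.ofReal_eq_zero,
      Complex.ofReal_eq_zero]
  constructor
  · rintro ⟨V, hV, h⟩
    have hn : Complex.normSq (V 0 0) + Complex.normSq (V 1 0) = 1 := by
      have := congrFun₂ (mem_unitaryGroup_iff'.1 hV) 0 0
      rw [mul_apply, Fin.sum_univ_two] at this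
      simpa [star_eq_conjTranspose, Complex.normSq_apply] using congrArg Complex.re this
    obtain ⟨n, hn'⟩ : ∃ n, n = star (V 0 0) * V 1 0 := ⟨_, rfl⟩
    refine ⟨2 * n.re, 2 * n.im, Complex.normSq (V 0 0) - Complex.normSq (V 1 0), ?_,
      (key V hV _ _ _ ?_ ?_ ?_).1 h⟩
    · have : n.re ^ 2 + n.im ^ 2 = Complex.normSq (V 0 0) * Complex.normSq (V 1 0) := by
        rw [hn']
        simp [Complex.normSq_apply]
        ring
      linear_combination 4 * this +
        (Complex.normSq (V 0 0) + Complex.normSq (V 1 0) + 1) * hn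
    · rw [Complex.star_def, ← Complex.normSq_eq_conj_mul_self]
      congr 1
      linarith
    · rw [Complex.star_def, ← Complex.normSq_eq_conj_mul_self]
      congr 1
      linarith
    · rw [← hn']
      apply Complex.ext <;> simp
  · rintro ⟨x, y, z, hn, h⟩
    obtain ⟨a, b, h₀, h₁, h₂⟩ := exists_hopf_eq hn
    have hV : !![a, -star b; b, star a] ∈ unitaryGroup (Fin 2) ℂ := by
      rw [mem_unitaryGroup_iff']
      simp at h₀ h₁
      ext i j
      fin_cases i <;> fin_cases j <;> simp [star_eq_conjTranspose, mul_apply, Fin.sum_univ_two]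
      · linear_combination h₀ + h₁
      · ring
      · ring
      · linear_combination h₀ + h₁
    exact ⟨_, hV, (key _ hV x y z h₀ h₁ h₂).2 h⟩

lemma star_det_mul_det_mul_eq_one {A V : Matrix (Fin 2) (Fin 2) ℂ} (hA : A.det = 1)
    (hV : V ∈ unitaryGroup (Fin 2) ℂ) : star (A * V).det * (A * V).det = 1 := by
  rw [det_mul, hA, one_mul]
  exact Unitary.star_mul_self_of_mem (det_of_mem_unitary hV)

lemma conjTranspose_mul_self_apply_eq_one_iff {A V : Matrix (Fin 2) (Fin 2) ℂ}
    (hV : V ∈ unitaryGroup (Fin 2) ℂ) (i : Fin 2) :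
    ((A * V)ᴴ * (A * V)) i i = 1 ↔ (Vᴴ * (Aᴴ * A - 1) * V) i i = 0 := by
  have h : Vᴴ * (Aᴴ * A - 1) * V = (A * V)ᴴ * (A * V) - 1 := by
    rw [Matrix.mul_sub, Matrix.sub_mul, Matrix.mul_one, ← star_eq_conjTranspose V,
      mem_unitaryGroup_iff'.1 hV, star_eq_conjTranspose, conjTranspose_mul]
    simp only [Matrix.mul_assoc]
  rw [h, sub_apply, one_apply_eq, sub_eq_zero]

end Matrix

/-- **Joint unitary triangularization with opposite decoding orders.**
For complex `2 × 2` matrices `A₁, A₂` of unit determinant, there exist unitary matrices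
`U₁, U₂, V` such that `U₁ᴴ * A₁ * V` is upper triangular and `U₂ᴴ * A₂ * V` is lower
triangular, both with all diagonal entries equal to `1`, iff
`F₂(A₁ᴴA₁ − I, A₂ᴴA₂ − I) ≥ 0`. -/
theorem upper_lower_triangularization (A₁ A₂ : Matrix (Fin 2) (Fin 2) ℂ)
    (h₁ : A₁.det = 1) (h₂ : A₂.det = 1) :
    (∃ U₁ U₂ V : Matrix (Fin 2) (Fin 2) ℂ,
        U₁ ∈ Matrix.unitaryGroup (Fin 2) ℂ ∧ U₂ ∈ Matrix.unitaryGroup (Fin 2) ℂ ∧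
        V ∈ Matrix.unitaryGroup (Fin 2) ℂ ∧
        (U₁ᴴ * A₁ * V).BlockTriangular id ∧ (∀ j, (U₁ᴴ * A₁ * V) j j = 1) ∧
        ((U₂ᴴ * A₂ * V)ᵀ).BlockTriangular id ∧ (∀ j, (U₂ᴴ * A₂ * V) j j = 1)) ↔
      0 ≤ F2 (A₁ᴴ * A₁ - 1) (A₂ᴴ * A₂ - 1) := by
  have h : (∃ U₁ U₂ V : Matrix (Fin 2) (Fin 2) ℂ,
        U₁ ∈ Matrix.unitaryGroup (Fin 2) ℂ ∧ U₂ ∈ Matrix.unitaryGroup (Fin 2) ℂ ∧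
        V ∈ Matrix.unitaryGroup (Fin 2) ℂ ∧
        (U₁ᴴ * A₁ * V).BlockTriangular id ∧ (∀ j, (U₁ᴴ * A₁ * V) j j = 1) ∧
        ((U₂ᴴ * A₂ * V)ᵀ).BlockTriangular id ∧ (∀ j, (U₂ᴴ * A₂ * V) j j = 1)) ↔
      ∃ V ∈ Matrix.unitaryGroup (Fin 2) ℂ, (Vᴴ * (A₁ᴴ * A₁ - 1) * V) 0 0 = 0 ∧
        (Vᴴ * (A₂ᴴ * A₂ - 1) * V) 1 1 = 0 := by
    simp only [fun U V : Matrix (Fin 2) (Fin 2) ℂ => Matrix.mul_assoc Uᴴ A₁ V,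
      fun U V : Matrix (Fin 2) (Fin 2) ℂ => Matrix.mul_assoc Uᴴ A₂ V]
    constructor
    · rintro ⟨U₁, U₂, V, hU₁, hU₂, hV, hT₁, hd₁, hT₂, hd₂⟩
      exact ⟨V, hV,
        (conjTranspose_mul_self_apply_eq_one_iff hV 0).1
          ((exists_unitary_upper_iff (star_det_mul_det_mul_eq_one h₁ hV)).1
            ⟨U₁, hU₁, hT₁, hd₁⟩),
        (conjTranspose_mul_self_apply_eq_one_iff hV 1).1
          ((exists_unitary_lower_iff (star_det_mul_det_mul_eq_one h₂ hV)).1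
            ⟨U₂, hU₂, hT₂, hd₂⟩)⟩
    · rintro ⟨V, hV, e₁, e₂⟩
      obtain ⟨U₁, hU₁, hT₁, hd₁⟩ :=
        (exists_unitary_upper_iff (star_det_mul_det_mul_eq_one h₁ hV)).2
          ((conjTranspose_mul_self_apply_eq_one_iff hV 0).2 e₁)
      obtain ⟨U₂, hU₂, hT₂, hd₂⟩ :=
        (exists_unitary_lower_iff (star_det_mul_det_mul_eq_one h₂ hV)).2
          ((conjTranspose_mul_self_apply_eq_one_iff hV 1).2 e₂)
      exact ⟨U₁, U₂, V, hU₁, hU₂, hV, hT₁, hd₁, hT₂, hd₂⟩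
  rw [h]
  obtain ⟨s₀, s₁, s₂, s₃, hs, hS⟩ := exists_conjTranspose_mul_self_sub_one_eq_pauli h₁
  obtain ⟨t₀, t₁, t₂, t₃, ht, hT⟩ := exists_conjTranspose_mul_self_sub_one_eq_pauli h₂
  rw [hS, hT, exists_unitary_pauli_iff, F2_pauli, Complex.zero_le_real,
    exists_mem_sphere_iff hs (by linarith [neg_sq t₁, neg_sq t₂, neg_sq t₃])]
  ring_nf
  constructor <;> intro h <;> linarith
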